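/- Let E, F be real Banach spaces, Ω ⊆ ℝ^p and Ω' ⊆ ℝ^q nonempty open sets, n, m ≥ 1, and let T : C^n(Ω, E) → C^m(Ω', F) be an ℝ-linear biseparating map. Let h : Ω' → Ω be a homeomorphism with the support property: for every y ∈ Ω' and every f ∈ C^n(Ω, E) that vanishes on a neighborhood of h(y), one has (Tf)(y) = 0. Suppose 0 ∈ Ω and y ∈ Ω' satisfies h(y) = 0. If f ∈ C^n(Ω, E) satisfies ∂^λ f(0, 0, …, 0) = 0 for every multi-index λ with |λ| ≤ n, then (Tf)(y) = 0. -/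

import Mathlib

open Set Filter Topology

/-- The partial derivative of `f` with respect to the `i`-th coordinate. -/
noncomputable def partialD {p : ℕ} {E : Type*} [NormedAddCommGroup E] [NormedSpace ℝ E]
    (i : Fin p) (f : (Fin p → ℝ) → E) : (Fin p → ℝ) → E :=
  fun x => fderiv ℝ f x (Pi.single i 1)

/-- The iterated partial derivative `∂^λ f` associated with a multi-index `λ`. -/
noncomputable def pdMulti {p : ℕ} {E : Type*} [NormedAddCommGroup E] [NormedSpace ℝ E]
    (lam : Fin p → ℕ) (f : (Fin p → ℝ) → E) : (Fin p → ℝ) → E :=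
  (List.finRange p).foldr (fun i g => (partialD i)^[lam i] g) f

/-- The space `C^n(Ω, E)`, as a submodule of the functions `ℝ^p → E`. -/
def Cspace (p n : ℕ) (Ω : Set (Fin p → ℝ)) (E : Type*) [NormedAddCommGroup E]
    [NormedSpace ℝ E] : Submodule ℝ ((Fin p → ℝ) → E) where
  carrier := {f | ContDiffOn ℝ n f Ω}
  add_mem' hf hg := hf.add hg
  zero_mem' := contDiffOn_const
  smul_mem' c f hf := hf.const_smul c

section PartialDerivatives

variable {p : ℕ} {E : Type*} [NormedAddCommGroup E] [NormedSpace ℝ E]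

lemma ContDiffOn.partialD {Ω : Set (Fin p → ℝ)} (hΩ : IsOpen Ω) {n : ℕ}
    {f : (Fin p → ℝ) → E} (hf : ContDiffOn ℝ (n + 1 : ℕ) f Ω) (i : Fin p) :
    ContDiffOn ℝ n (partialD i f) Ω :=
  (hf.fderiv_of_isOpen hΩ (by norm_cast)).clm_apply contDiffOn_const

lemma Set.EqOn.partialD {Ω : Set (Fin p → ℝ)} (hΩ : IsOpen Ω) {f g : (Fin p → ℝ) → E}
    (hfg : EqOn f g Ω) (i : Fin p) : EqOn (partialD i f) (partialD i g) Ω := fun x hx => by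
  have : f =ᶠ[𝓝 x] g := hfg.eventuallyEq_of_mem (hΩ.mem_nhds hx)
  simp only [_root_.partialD, this.fderiv_eq]

lemma partialD_comm {Ω : Set (Fin p → ℝ)} (hΩ : IsOpen Ω) {f : (Fin p → ℝ) → E}
    (hf : ContDiffOn ℝ 2 f Ω) (i j : Fin p) :
    EqOn (partialD i (partialD j f)) (partialD j (partialD i f)) Ω := fun x hx => by
  have hfx : ContDiffAt ℝ 2 f x := hf.contDiffAt (hΩ.mem_nhds hx)
  have hd : DifferentiableAt ℝ (fderiv ℝ f) x :=
    (hfx.fderiv_right (m := 1) (by norm_num)).differentiableAt (by norm_num)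
  have key : ∀ a b : Fin p, partialD a (partialD b f) x =
      fderiv ℝ (fderiv ℝ f) x (Pi.single a 1) (Pi.single b 1) := fun a b => by
    unfold partialD
    rw [fderiv_clm_apply hd (by fun_prop)]
    simp
  rw [key, key]
  exact (hfx.isSymmSndFDerivAt (by simp)).eq _ _

/-- The iterated partial derivative along a word of coordinates, the head being applied last. -/
noncomputable def wordD (w : List (Fin p)) (f : (Fin p → ℝ) → E) : (Fin p → ℝ) → E :=
  w.foldr partialD f

lemma ContDiffOn.wordD {Ω : Set (Fin p → ℝ)} (hΩ : IsOpen Ω) (w : List (Fin p)) {n : ℕ}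
    {f : (Fin p → ℝ) → E} (hf : ContDiffOn ℝ (n + w.length : ℕ) f Ω) :
    ContDiffOn ℝ n (wordD w f) Ω := by
  induction w generalizing n with
  | nil => exact hf
  | cons i w ih =>
    refine ContDiffOn.partialD hΩ (ih ?_) i
    rwa [List.length_cons, ← add_assoc, add_right_comm] at hf

lemma wordD_perm {Ω : Set (Fin p → ℝ)} (hΩ : IsOpen Ω) {v w : List (Fin p)} (hvw : v.Perm w)
    {f : (Fin p → ℝ) → E} (hf : ContDiffOn ℝ v.length f Ω) :
    EqOn (wordD v f) (wordD w f) Ω := by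
  induction hvw with
  | nil => exact fun _ _ => rfl
  | cons i _ ih =>
    exact (ih (hf.of_le (by simp))).partialD hΩ i
  | swap i j l =>
    refine partialD_comm hΩ (f := wordD l f) (ContDiffOn.wordD hΩ (n := 2) l ?_) j i
    convert hf using 2
    simp only [List.length_cons]
    ring
  | trans h₁ _ ih₁ ih₂ =>
    exact (ih₁ hf).trans (ih₂ (h₁.length_eq ▸ hf))

lemma wordD_replicate (k : ℕ) (i : Fin p) (f : (Fin p → ℝ) → E) :
    wordD (List.replicate k i) f = (partialD i)^[k] f := by
  induction k with
  | zero => rfl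
  | succ k ih =>
    rw [List.replicate_succ, Function.iterate_succ_apply', ← ih]
    rfl

lemma pdMulti_eq_wordD (lam : Fin p → ℕ) (f : (Fin p → ℝ) → E) :
    pdMulti lam f = wordD ((List.finRange p).flatMap fun i => List.replicate (lam i) i) f := by
  unfold pdMulti
  induction List.finRange p with
  | nil => rfl
  | cons i l ih =>
    rw [List.foldr_cons, ih, List.flatMap_cons, ← wordD_replicate]
    simp [wordD]

lemma wordD_eq_pdMulti_count {Ω : Set (Fin p → ℝ)} (hΩ : IsOpen Ω) (w : List (Fin p))
    {f : (Fin p → ℝ) → E} (hf : ContDiffOn ℝ w.length f Ω) :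
    EqOn (wordD w f) (pdMulti (fun i => w.count i) f) Ω := by
  rw [pdMulti_eq_wordD]
  refine wordD_perm hΩ (List.perm_iff_count.2 fun a => ?_) hf
  rw [List.count_flatMap, ← Fin.sum_univ_def]
  simp [List.count_replicate]

/-- `f` is `C^n` on `Ω` and all its iterated partial derivatives of order at most `n` vanish at
the origin, whatever the order of differentiation. -/
def FlatOn (n : ℕ) (Ω : Set (Fin p → ℝ)) (f : (Fin p → ℝ) → E) : Prop :=
  ContDiffOn ℝ n f Ω ∧ ∀ w : List (Fin p), w.length ≤ n → wordD w f 0 = 0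

namespace FlatOn

variable {Ω : Set (Fin p → ℝ)} {f : (Fin p → ℝ) → E} {n : ℕ}

lemma apply_zero (hf : FlatOn n Ω f) : f 0 = 0 := hf.2 [] (Nat.zero_le _)

lemma of_le {m : ℕ} (hf : FlatOn n Ω f) (hmn : m ≤ n) : FlatOn m Ω f :=
  ⟨hf.1.of_le (by exact_mod_cast hmn), fun w hw => hf.2 w (hw.trans hmn)⟩

lemma partialD (hΩ : IsOpen Ω) (hf : FlatOn (n + 1) Ω f) (i : Fin p) :
    FlatOn n Ω (partialD i f) := by
  refine ⟨hf.1.partialD hΩ i, fun w hw => ?_⟩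
  have := hf.2 (w ++ [i]) (by simpa using hw)
  rwa [wordD, List.foldr_append] at this

lemma of_pdMulti (hΩ : IsOpen Ω) (h0 : (0 : Fin p → ℝ) ∈ Ω) (hf : ContDiffOn ℝ n f Ω)
    (hflat : ∀ lam : Fin p → ℕ, (∑ i, lam i) ≤ n → pdMulti lam f 0 = 0) : FlatOn n Ω f := by
  refine ⟨hf, fun w hw => ?_⟩
  rw [wordD_eq_pdMulti_count hΩ w (hf.of_le (by exact_mod_cast hw)) h0]
  refine hflat _ (le_trans (le_of_eq ?_) hw)
  simpa using Multiset.sum_count_eq_card (s := Finset.univ) (m := (w : Multiset (Fin p)))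
    (fun _ _ => Finset.mem_univ _)

end FlatOn

lemma norm_clm_le_sum_norm_single (L : (Fin p → ℝ) →L[ℝ] E) :
    ‖L‖ ≤ ∑ i, ‖L (Pi.single i 1)‖ := by
  refine L.opNorm_le_bound (Finset.sum_nonneg fun _ _ => norm_nonneg _) fun x => ?_
  conv_lhs => rw [pi_eq_sum_univ' x, map_sum]
  rw [Finset.sum_mul]
  refine (norm_sum_le _ _).trans (Finset.sum_le_sum fun i _ => ?_)
  rw [map_smul, norm_smul, mul_comm]
  exact mul_le_mul_of_nonneg_left (norm_le_pi_norm x i) (norm_nonneg _)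

/-- A function which is `n`-flat at the origin is `o(‖x‖ ^ n)` there. -/
lemma FlatOn.isLittleO {Ω : Set (Fin p → ℝ)} (hΩ : IsOpen Ω) (h0 : (0 : Fin p → ℝ) ∈ Ω) {n : ℕ}
    {f : (Fin p → ℝ) → E} (hf : FlatOn n Ω f) :
    f =o[𝓝 0] fun x => ‖x‖ ^ n := by
  induction n generalizing f with
  | zero =>
    have hc : ContinuousAt f 0 := hf.1.continuousOn.continuousAt (hΩ.mem_nhds h0)
    simpa [ContinuousAt, hf.apply_zero] using hc
  | succ n ih =>
    have hfd : fderiv ℝ f =o[𝓝 0] fun x => ‖x‖ ^ n := by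
      have hs : (fun x => ∑ i, ‖_root_.partialD i f x‖) =o[𝓝 0] fun x => ‖x‖ ^ n :=
        Asymptotics.IsLittleO.fun_sum fun i _ => (ih (hf.partialD hΩ i)).norm_left
      refine Asymptotics.IsBigO.trans_isLittleO (Asymptotics.IsBigO.of_bound 1 ?_) hs
      refine Eventually.of_forall fun x => ?_
      rw [one_mul]
      exact (norm_clm_le_sum_norm_single _).trans (Real.le_norm_self _)
    refine Asymptotics.IsLittleO.of_bound fun c hc => ?_
    obtain ⟨r, hr, hball⟩ := Metric.eventually_nhds_iff_ball.1
      ((hfd.bound hc).and (hΩ.mem_nhds h0))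
    filter_upwards [Metric.ball_mem_nhds (0 : Fin p → ℝ) hr] with x hx
    have hsub : Metric.closedBall (0 : Fin p → ℝ) ‖x‖ ⊆ Metric.ball 0 r :=
      Metric.closedBall_subset_ball (by simpa using hx)
    have := (convex_closedBall (0 : Fin p → ℝ) ‖x‖).norm_image_sub_le_of_norm_fderiv_le
      (𝕜 := ℝ) (f := f) (C := c * ‖x‖ ^ n) (x := 0) (y := x)
      (fun z hz => (hf.1.contDiffAt (hΩ.mem_nhds (hball z (hsub hz)).2)).differentiableAt
        (by simp))
      (fun z hz => ((hball z (hsub hz)).1).trans (by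
        rw [norm_pow, norm_norm]
        have : ‖z‖ ≤ ‖x‖ := by simpa using hz
        gcongr)) (by simp) (by simp)
    rw [hf.apply_zero, sub_zero, sub_zero] at this
    rw [norm_pow, norm_norm, pow_succ, ← mul_assoc]
    exact this

/-- `φ` is smooth away from the origin and positively homogeneous of degree `-k`. -/
def SmoothNegHomogeneous (k : ℕ) (φ : (Fin p → ℝ) → ℝ) : Prop :=
  (∀ x ≠ 0, ∀ n : ℕ, ContDiffAt ℝ n φ x) ∧ ∀ t : ℝ, 0 < t → ∀ x ≠ 0, t ^ k * φ (t • x) = φ x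

namespace SmoothNegHomogeneous

variable {k : ℕ} {φ : (Fin p → ℝ) → ℝ}

lemma partialD (hφ : SmoothNegHomogeneous k φ) (i : Fin p) :
    SmoothNegHomogeneous (k + 1) (partialD i φ) := by
  refine ⟨fun x hx n => ?_, fun t ht x hx => ?_⟩
  · exact ((hφ.1 x hx (n + 1)).fderiv_right (m := n) (by norm_cast)).clm_apply contDiffAt_const
  · have heq : (fun z => t ^ k * φ (t • z)) =ᶠ[𝓝 x] φ := by
      filter_upwards [isOpen_ne.mem_nhds hx] with z hz using hφ.2 t ht z hz
    have htx : t • x ≠ 0 := smul_ne_zero ht.ne' hx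
    have hd : DifferentiableAt ℝ (fun z => φ (t • z)) x := by
      have := (hφ.1 _ htx 1).differentiableAt (by simp)
      fun_prop
    unfold _root_.partialD
    rw [← heq.fderiv_eq, fderiv_const_mul hd, fderiv_comp_smul]
    simp only [_root_.smul_apply, smul_eq_mul]
    ring

lemma exists_bound (hφ : SmoothNegHomogeneous k φ) :
    ∃ C : ℝ, ∀ x ≠ 0, ‖x‖ ^ k * ‖φ x‖ ≤ C := by
  have hcont : ContinuousOn φ (Metric.sphere 0 1) := fun x hx =>
    (hφ.1 x (by rintro rfl; simp at hx) 0).continuousAt.continuousWithinAt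
  obtain ⟨C, hC⟩ := (isCompact_sphere (0 : Fin p → ℝ) 1).exists_bound_of_continuousOn hcont
  refine ⟨C, fun x hx => ?_⟩
  have hx' : ‖x‖ ≠ 0 := norm_ne_zero_iff.2 hx
  have := hφ.2 ‖x‖ (norm_pos_iff.2 hx) (‖x‖⁻¹ • x) (smul_ne_zero (inv_ne_zero hx') hx)
  rw [smul_inv_smul₀ hx'] at this
  calc ‖x‖ ^ k * ‖φ x‖ = ‖‖x‖ ^ k * φ x‖ := by simp
    _ = ‖φ (‖x‖⁻¹ • x)‖ := by rw [this]
    _ ≤ C := hC _ (by simp [norm_smul, hx'])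

variable {Ω : Set (Fin p → ℝ)} {f : (Fin p → ℝ) → E} {n : ℕ}

lemma smul_isLittleO (hφ : SmoothNegHomogeneous k φ) (hΩ : IsOpen Ω)
    (h0 : (0 : Fin p → ℝ) ∈ Ω) (hf : FlatOn (n + k) Ω f) :
    (fun x => φ x • f x) =o[𝓝 0] fun x => ‖x‖ ^ n := by
  obtain ⟨C, hC⟩ := hφ.exists_bound
  refine Asymptotics.IsLittleO.of_bound fun c hc => ?_
  have hC' : 0 < max C 1 := lt_max_of_lt_right one_pos
  filter_upwards [(hf.isLittleO hΩ h0).bound (div_pos hc hC')] with x hx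
  rcases eq_or_ne x 0 with rfl | hx0
  · rw [hf.apply_zero, smul_zero, norm_zero]
    positivity
  · rw [norm_smul]
    calc ‖φ x‖ * ‖f x‖ ≤ ‖φ x‖ * (c / max C 1 * ‖‖x‖ ^ (n + k)‖) := by gcongr
      _ = (‖x‖ ^ k * ‖φ x‖) * (c / max C 1 * ‖x‖ ^ n) := by
        rw [norm_pow, norm_norm]; ring
      _ ≤ max C 1 * (c / max C 1 * ‖x‖ ^ n) := by
        have := (hC x hx0).trans (le_max_left C 1)
        gcongr
      _ = c * ‖‖x‖ ^ n‖ := by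
        rw [norm_pow, norm_norm]; field_simp

lemma contDiffOn_smul (hφ : SmoothNegHomogeneous k φ) (hΩ : IsOpen Ω)
    (h0 : (0 : Fin p → ℝ) ∈ Ω) (hf : FlatOn (n + k) Ω f) :
    ContDiffOn ℝ n (fun x => φ x • f x) Ω := by
  induction n generalizing k φ f with
  | zero =>
    rw [Nat.cast_zero, contDiffOn_zero]
    intro x hx
    refine ContinuousAt.continuousWithinAt ?_
    rcases eq_or_ne x 0 with rfl | hx0
    · have := hφ.smul_isLittleO hΩ h0 hf
      simp only [pow_zero, Asymptotics.isLittleO_one_iff] at this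
      simpa [ContinuousAt, hf.apply_zero] using this
    · exact (hφ.1 x hx0 0).continuousAt.smul (hf.1.continuousOn.continuousAt (hΩ.mem_nhds hx))
  | succ n ih =>
    have hd0 : HasFDerivAt (fun x => φ x • f x) (0 : (Fin p → ℝ) →L[ℝ] E) 0 := by
      have : FlatOn (1 + k) Ω f := hf.of_le (by omega)
      have := hφ.smul_isLittleO hΩ h0 this
      simp only [pow_one] at this
      rw [hasFDerivAt_iff_isLittleO_nhds_zero]
      simpa [hf.apply_zero] using this.of_norm_right
    have hdf : ∀ x ∈ Ω, DifferentiableAt ℝ f x := fun x hx =>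
      (hf.1.contDiffAt (hΩ.mem_nhds hx)).differentiableAt (by norm_cast; omega)
    have hdφ : ∀ x ≠ 0, DifferentiableAt ℝ φ x := fun x hx =>
      (hφ.1 x hx 1).differentiableAt (by simp)
    have hdiff : DifferentiableOn ℝ (fun x => φ x • f x) Ω := fun x hx => by
      rcases eq_or_ne x 0 with rfl | hx0
      · exact hd0.differentiableAt.differentiableWithinAt
      · exact ((hdφ x hx0).smul (hdf x hx)).differentiableWithinAt
    have hf' : FlatOn (n + k + 1) Ω f := by rwa [add_right_comm] at hf
    have hpart : ∀ i, ContDiffOn ℝ n (_root_.partialD i fun x => φ x • f x) Ω := fun i => by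
      refine ((ih (hφ.partialD i) hf').add (ih hφ (hf'.partialD hΩ i))).congr fun x hx => ?_
      rcases eq_or_ne x 0 with rfl | hx0
      · rw [(hf'.partialD hΩ i).apply_zero, hf.apply_zero]
        simp [_root_.partialD, hd0.fderiv]
      · simp only [_root_.partialD]
        rw [fderiv_fun_smul (hdφ x hx0) (hdf x hx)]
        simp [add_comm]
    rw [Nat.cast_succ]
    refine (contDiffOn_succ_iff_fderiv_apply hΩ.uniqueDiffOn).2 ⟨hdiff, by simp, fun v => ?_⟩
    refine (ContDiffOn.sum (s := Finset.univ)
      fun i _ => (hpart i).const_smul (v i)).congr fun x hx => ?_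
    rw [fderivWithin_of_isOpen hΩ hx]
    conv_lhs => rw [pi_eq_sum_univ' v, map_sum]
    refine Finset.sum_congr rfl fun i _ => ?_
    rw [map_smul]
    rfl

end SmoothNegHomogeneous

/-- An angular cutoff: smooth off the origin, homogeneous of degree zero, equal to `1` near the
positive `i`-th half-axis and to `0` near the negative one. -/
noncomputable def angularCutoff (i : Fin p) (x : Fin p → ℝ) : ℝ :=
  Real.smoothTransition (2 * x i / √(∑ j, x j ^ 2))

lemma sum_sq_pos_of_ne_zero {x : Fin p → ℝ} (hx : x ≠ 0) : 0 < ∑ j, x j ^ 2 := by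
  obtain ⟨j, hj⟩ := Function.ne_iff.1 hx
  exact Finset.sum_pos' (fun _ _ => sq_nonneg _)
    ⟨j, Finset.mem_univ _, by have : x j ≠ 0 := hj; positivity⟩

lemma smoothNegHomogeneous_angularCutoff (i : Fin p) :
    SmoothNegHomogeneous 0 (angularCutoff i) := by
  refine ⟨fun x hx n => ?_, fun t ht x hx => ?_⟩
  · have hs := sum_sq_pos_of_ne_zero hx
    refine (Real.smoothTransition.contDiffAt (n := n)).comp x ?_
    refine ContDiffAt.div (by fun_prop) (ContDiffAt.sqrt (by fun_prop) hs.ne') ?_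
    exact (Real.sqrt_pos.2 hs).ne'
  · have : ∑ j, (t • x) j ^ 2 = t ^ 2 * ∑ j, x j ^ 2 := by
      simp [Finset.mul_sum, mul_pow]
    rw [pow_zero, one_mul, angularCutoff, angularCutoff, this, Real.sqrt_mul (sq_nonneg t),
      Real.sqrt_sq ht.le, Pi.smul_apply, smul_eq_mul, mul_left_comm, mul_div_mul_left _ _ ht.ne']

lemma eventually_angularCutoff_eq_one (i : Fin p) {t : ℝ} (ht : 0 < t) :
    ∀ᶠ x in 𝓝 (Pi.single i t : Fin p → ℝ), angularCutoff i x = 1 := by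
  have hsum : ∑ j, (Pi.single i t : Fin p → ℝ) j ^ 2 = t ^ 2 := by
    rw [Finset.sum_eq_single i] <;> simp +contextual
  have hc : ContinuousAt (fun x : Fin p → ℝ => 2 * x i / √(∑ j, x j ^ 2)) (Pi.single i t) := by
    have hnum : Continuous fun x : Fin p → ℝ => 2 * x i := by fun_prop
    have hden : Continuous fun x : Fin p → ℝ => √(∑ j, x j ^ 2) :=
      (continuous_finsetSum _ fun j _ => (continuous_apply j).pow 2).sqrt
    refine hnum.continuousAt.div hden.continuousAt ?_
    rw [hsum, Real.sqrt_sq ht.le]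
    exact ht.ne'
  have hlt : 1 < 2 * (Pi.single i t : Fin p → ℝ) i /
      √(∑ j, (Pi.single i t : Fin p → ℝ) j ^ 2) := by
    rw [hsum, Real.sqrt_sq ht.le, Pi.single_eq_same, mul_div_cancel_right₀ _ ht.ne']
    norm_num
  filter_upwards [hc.eventually_const_lt hlt] with x hx
  exact Real.smoothTransition.one_of_one_le hx.le

lemma eventually_angularCutoff_eq_zero (i : Fin p) {t : ℝ} (ht : 0 < t) :
    ∀ᶠ x in 𝓝 (Pi.single i (-t) : Fin p → ℝ), angularCutoff i x = 0 := by
  have hc : ContinuousAt (fun x : Fin p → ℝ => x i) (Pi.single i (-t)) :=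
    (continuous_apply i).continuousAt
  have hlt : (Pi.single i (-t) : Fin p → ℝ) i < 0 := by simpa using ht
  filter_upwards [hc.eventually_lt_const hlt] with x hx
  exact Real.smoothTransition.zero_of_nonpos
    (div_nonpos_of_nonpos_of_nonneg (by linarith) (Real.sqrt_nonneg _))

/-- A continuous function vanishing along the image of a punctured half-axis under a continuous map
vanishes at the image of the origin. -/
lemma apply_zero_of_vanishing_on_ray {X : Type*} [TopologicalSpace X] {F : Type*}
    [NormedAddCommGroup F] {Ω : Set (Fin p → ℝ)} (hΩ : IsOpen Ω) (h0 : (0 : Fin p → ℝ) ∈ Ω)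
    {Ω' : Set X} (hΩ' : IsOpen Ω') {h' : (Fin p → ℝ) → X} (hh' : ContinuousOn h' Ω)
    (h'0 : h' 0 ∈ Ω') {u : X → F} (hu : ContinuousOn u Ω') (i : Fin p) (s : ℝ)
    (hzero : ∀ t : ℝ, 0 < t → Pi.single i (s * t) ∈ Ω → u (h' (Pi.single i (s * t))) = 0) :
    u (h' 0) = 0 := by
  have hray : Tendsto (fun t : ℝ => (Pi.single i (s * t) : Fin p → ℝ)) (𝓝[>] 0) (𝓝 0) := by
    have hc : Continuous fun t : ℝ => (Pi.single i (s * t) : Fin p → ℝ) :=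
      (continuous_single i).comp (continuous_const.mul continuous_id)
    have := hc.tendsto 0
    rw [mul_zero, Pi.single_zero] at this
    exact this.mono_left nhdsWithin_le_nhds
  have hlim := (hu.continuousAt (hΩ'.mem_nhds h'0)).tendsto.comp
    ((hh'.continuousAt (hΩ.mem_nhds h0)).tendsto.comp hray)
  refine tendsto_nhds_unique hlim (tendsto_const_nhds.congr' ?_)
  filter_upwards [self_mem_nhdsWithin, hray.eventually (hΩ.mem_nhds h0)] with t ht htΩ
  exact (hzero t ht htΩ).symm

end PartialDerivatives

/-- if `T` is a linear biseparating map, `h` a homeomorphism from `Ω'` onto `Ω`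
with the support property, `h(y) = 0 ∈ Ω`, and all partial derivatives of `f` of order at most
`n` vanish at the origin, then `(Tf)(y) = 0`. -/
theorem value_zero_of_flat_at_support_point {p q n m : ℕ} {E F : Type*}
    [NormedAddCommGroup E] [NormedSpace ℝ E] [CompleteSpace E]
    [NormedAddCommGroup F] [NormedSpace ℝ F] [CompleteSpace F]
    {Ω : Set (Fin p → ℝ)} {Ω' : Set (Fin q → ℝ)}
    (hΩ : IsOpen Ω) (hΩne : Ω.Nonempty) (hΩ' : IsOpen Ω') (hΩ'ne : Ω'.Nonempty)
    (hn : 1 ≤ n) (hm : 1 ≤ m)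
    (T : Cspace p n Ω E →ₗ[ℝ] Cspace q m Ω' F)
    (hbij : Function.Bijective T)
    (hsep : ∀ f g : Cspace p n Ω E, (∀ x ∈ Ω, f.1 x = 0 ∨ g.1 x = 0) →
      ∀ y ∈ Ω', (T f).1 y = 0 ∨ (T g).1 y = 0)
    (hsep' : ∀ f g : Cspace p n Ω E, (∀ y ∈ Ω', (T f).1 y = 0 ∨ (T g).1 y = 0) →
      ∀ x ∈ Ω, f.1 x = 0 ∨ g.1 x = 0)
    (h : (Fin q → ℝ) → (Fin p → ℝ)) (h' : (Fin p → ℝ) → (Fin q → ℝ))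
    (hh : ContinuousOn h Ω') (hh' : ContinuousOn h' Ω)
    (hhBij : Set.BijOn h Ω' Ω)
    (hinv1 : ∀ y ∈ Ω', h' (h y) = y) (hinv2 : ∀ x ∈ Ω, h (h' x) = x)
    (hsupp : ∀ y ∈ Ω', ∀ f : Cspace p n Ω E,
      (∀ᶠ x in nhds (h y), f.1 x = 0) → (T f).1 y = 0)
    (h0 : (0 : Fin p → ℝ) ∈ Ω) (y : Fin q → ℝ) (hy : y ∈ Ω') (hhy : h y = 0)
    (f : Cspace p n Ω E)
    (hflat : ∀ lam : Fin p → ℕ, (∑ i, lam i) ≤ n → pdMulti lam f.1 0 = 0) :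
    (T f).1 y = 0 := by
  have hflatOn : FlatOn n Ω f.1 := FlatOn.of_pdMulti hΩ h0 f.2 hflat
  have h'0 : h' 0 = y := by rw [← hhy, hinv1 y hy]
  rcases isEmpty_or_nonempty (Fin p) with hp | ⟨⟨i⟩⟩
  · refine hsupp y hy f (Eventually.of_forall fun x => ?_)
    rw [Subsingleton.elim x 0]
    exact hflatOn.apply_zero
  have hmem : ∀ x ∈ Ω, h' x ∈ Ω' := fun x hx => by
    obtain ⟨z, hz, rfl⟩ := hhBij.surjOn hx
    rwa [hinv1 z hz]
  let g : Cspace p n Ω E := ⟨fun x => angularCutoff i x • f.1 x,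
    (smoothNegHomogeneous_angularCutoff i).contDiffOn_smul hΩ h0 (n := n) hflatOn⟩
  have vanish : ∀ (k : Cspace p n Ω E) (s : ℝ),
      (∀ t : ℝ, 0 < t → ∀ᶠ x in 𝓝 (Pi.single i (s * t) : Fin p → ℝ), k.1 x = 0) →
      (T k).1 y = 0 := fun k s hk => by
    rw [← h'0] at hy ⊢
    refine apply_zero_of_vanishing_on_ray hΩ h0 hΩ' hh' hy (ContDiffOn.continuousOn (T k).2) i s
      fun t ht htΩ => hsupp _ (hmem _ htΩ) k ?_
    rw [hinv2 _ htΩ]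
    exact hk t ht
  have hg : (T g).1 y = 0 := vanish g (-1) fun t ht => by
    rw [neg_one_mul]
    filter_upwards [eventually_angularCutoff_eq_zero i ht] with x hx
    simp [g, hx]
  have hfg : (T (f - g)).1 y = 0 := vanish (f - g) 1 fun t ht => by
    rw [one_mul]
    filter_upwards [eventually_angularCutoff_eq_one i ht] with x hx
    simp [g, hx]
  rw [map_sub] at hfg
  simpa [hg] using hfg
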